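/- arXiv:math-ph/0501067 — 3 statements merged into one kernel-verified Lean document; each statement's English description precedes it below -/
import Mathlib

section
/- Let d ≥ 1 and for each μ > 0 define J_μ : ℤ^d → ℝ by J_μ(0) = 0 and J_μ(x) = c_μ e^{−μ |x|₁} for x ≠ 0, where |x|₁ = Σ_{i=1}^{d} |x_i| and the constant c_μ > 0 is chosen so that Σ_{x ∈ ℤ^d} J_μ(x) = 1. Let Ĵ_μ(k) = Σ_{x ∈ ℤ^d} J_μ(x) e^{i k·x}. Then: (1) there exist C > 0 and μ₀ > 0 such that 1 − Ĵ_μ(k) ≥ C |k|² for all 0 < μ ≤ μ₀ and all k ∈ [−π, π]^d, where |k| is the Euclidean norm; (2) Σ_{x ∈ ℤ^d} J_μ(x)² → 0 as μ ↓ 0. Consequently, if d ≥ 3, then ∫_{[−π,π]^d} Ĵ_μ(k)² / (1 − Ĵ_μ(k)) dk/(2π)^d → 0 as μ ↓ 0. -/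
open Real Set Filter Topology MeasureTheory

noncomputable section

/-- The ℓ¹-norm of a point of `ℤ^d`, as a real number. -/
noncomputable def l1norm {d : ℕ} (x : Fin d → ℤ) : ℝ :=
  ∑ i, |(x i : ℝ)|

/-- The normalized Yukawa interaction `J_μ(x) = c_μ e^{-μ|x|₁}` for `x ≠ 0`,
`J_μ(0) = 0`, with `c_μ` chosen so that `Σ_x J_μ(x) = 1`. -/
noncomputable def yukawa (d : ℕ) (μ : ℝ) (x : Fin d → ℤ) : ℝ :=
  if x = 0 then 0 else
    (∑' y : Fin d → ℤ, if y = 0 then (0 : ℝ) else Real.exp (-μ * l1norm y))⁻¹ *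
      Real.exp (-μ * l1norm x)

/-- The (real-valued) Fourier transform `Ĵ(k) = Σ_x J(x) e^{i k·x}` of an even,
absolutely summable `J : ℤ^d → ℝ`; by evenness it equals `Σ_x J(x) cos(k·x)`. -/
noncomputable def jhat (d : ℕ) (J : (Fin d → ℤ) → ℝ) (k : Fin d → ℝ) : ℝ :=
  ∑' x : Fin d → ℤ, J x * Real.cos (∑ i, k i * (x i : ℝ))

/-- The Brillouin zone `[-π, π]^d`. -/
def brillouin (d : ℕ) : Set (Fin d → ℝ) :=
  Icc (fun _ => -π) (fun _ => π)

/-- The infrared integral `I(J) = ∫_{[-π,π]^d} Ĵ(k)²/(1-Ĵ(k)) dk/(2π)^d`. -/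
noncomputable def irIntegral (d : ℕ) (J : (Fin d → ℤ) → ℝ) : ℝ :=
  (1 / (2 * π) ^ d) * ∫ k in brillouin d, jhat d J k ^ 2 / (1 - jhat d J k)

/-- The sum over `n ∈ ℤ` of `e^{-μ|n|} e^{inθ}`, that is, an unnormalized Poisson kernel. -/
def poissonSum (μ θ : ℝ) : ℝ :=
  (1 - exp (-μ) ^ 2) / (1 - 2 * exp (-μ) * cos θ + exp (-μ) ^ 2)

lemma hasSum_exp_neg_abs_mul_cexp {μ : ℝ} (hμ : 0 < μ) (θ : ℝ) :
    HasSum (fun n : ℤ => (exp (-μ * |(n : ℝ)|) : ℂ) * Complex.exp (θ * n * Complex.I))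
      (poissonSum μ θ) := by
  set a : ℂ := Complex.exp (-μ + θ * Complex.I) with ha
  set b : ℂ := Complex.exp (-μ - θ * Complex.I) with hb
  have hna : ‖a‖ < 1 := by simpa [ha, Complex.norm_exp] using hμ
  have hnb : ‖b‖ < 1 := by simpa [hb, Complex.norm_exp] using hμ
  have ha1 : 1 - a ≠ 0 := fun h => by simp [← sub_eq_zero.1 h] at hna
  have hb1 : 1 - b ≠ 0 := fun h => by simp [← sub_eq_zero.1 h] at hnb
  have hab : a * b = (exp (-μ) : ℂ) ^ 2 := by
    rw [ha, hb, ← Complex.exp_add, Complex.ofReal_exp, ← Complex.exp_nat_mul]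
    congr 1; push_cast; ring
  have hadd : a + b = 2 * (exp (-μ) : ℂ) * (cos θ : ℂ) := by
    rw [ha, hb, Complex.exp_add, sub_eq_add_neg, Complex.exp_add, Complex.ofReal_exp,
      Complex.ofReal_cos, mul_assoc, mul_left_comm, Complex.two_cos]
    push_cast; ring_nf
  have hval : (poissonSum μ θ : ℂ) = (1 - a)⁻¹ + b * (1 - b)⁻¹ := by
    have hden : (1 : ℂ) - 2 * (exp (-μ) : ℂ) * (cos θ : ℂ) + (exp (-μ) : ℂ) ^ 2
        = (1 - a) * (1 - b) := by rw [← hab, ← hadd]; ring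
    unfold poissonSum
    simp only [Complex.ofReal_div, Complex.ofReal_sub, Complex.ofReal_add,
      Complex.ofReal_mul, Complex.ofReal_pow, Complex.ofReal_one, Complex.ofReal_ofNat]
    rw [hden, ← hab]
    field_simp
    ring
  rw [hval]
  refine HasSum.of_nat_of_neg_add_one ?_ ?_
  · refine (hasSum_geometric_of_norm_lt_one hna).congr_fun fun n => ?_
    rw [ha, ← Complex.exp_nat_mul, Complex.ofReal_exp, ← Complex.exp_add]
    congr 1
    simp only [Int.cast_natCast, Nat.abs_cast]
    push_cast; ring
  · refine ((hasSum_geometric_of_norm_lt_one hnb).mul_left b).congr_fun fun n => ?_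
    rw [← pow_succ', hb, ← Complex.exp_nat_mul, Complex.ofReal_exp, ← Complex.exp_add]
    congr 1
    have : |((-((n : ℤ) + 1) : ℤ) : ℝ)| = n + 1 := by
      push_cast; rw [abs_neg, abs_of_nonneg (by positivity)]
    rw [this]
    push_cast; ring

lemma HasSum.prod_pi_fin {ι R : Type*} [NormedCommRing R] [CompleteSpace R] {d : ℕ}
    {f : Fin d → ι → R} {s : Fin d → R} (hf : ∀ i, HasSum (f i) (s i))
    (hn : ∀ i, Summable fun n => ‖f i n‖) :
    HasSum (fun x : Fin d → ι => ∏ i, f i (x i)) (∏ i, s i) ∧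
      Summable fun x : Fin d → ι => ‖∏ i, f i (x i)‖ := by
  induction d with
  | zero => exact ⟨by simp, .of_finite⟩
  | succ d ih =>
    obtain ⟨h1, h2⟩ := ih (fun i => hf i.succ) (fun i => hn i.succ)
    let g : (Fin d → ι) → R := fun y => ∏ i, f (Fin.succ i) (y i)
    have h3 : Summable fun x : ι × (Fin d → ι) => ‖f 0 x.1 * g x.2‖ :=
      Summable.mul_norm (f := f 0) (g := g) (hn 0) h2
    have h4 : HasSum (fun x : ι × (Fin d → ι) => f 0 x.1 * g x.2)
        (s 0 * ∏ i : Fin d, s i.succ) :=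
      HasSum.mul (f := f 0) (g := g) (hf 0) h1 (Summable.of_norm h3)
    have h5 : (fun x : ι × (Fin d → ι) => f 0 x.1 * g x.2) =
        (fun x : Fin (d + 1) → ι => ∏ i, f i (x i)) ∘ Fin.consEquiv fun _ => ι := by
      ext x
      simp [g, Fin.consEquiv, Fin.prod_univ_succ]
    rw [← Fin.prod_univ_succ, h5] at h4
    refine ⟨(Fin.consEquiv fun _ => ι).hasSum_iff.1 h4,
      (Fin.consEquiv fun _ => ι).summable_iff.1 ?_⟩
    exact h3.congr fun x => congrArg norm (congrFun h5 x)

lemma hasSum_exp_neg_l1norm_mul_cos {d : ℕ} {μ : ℝ} (hμ : 0 < μ) (k : Fin d → ℝ) :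
    HasSum (fun x : Fin d → ℤ => exp (-μ * l1norm x) * cos (∑ i, k i * (x i : ℝ)))
      (∏ i, poissonSum μ (k i)) := by
  have hnorm (i : Fin d) : Summable fun n : ℤ =>
      ‖(exp (-μ * |(n : ℝ)|) : ℂ) * Complex.exp (k i * n * Complex.I)‖ :=
    (hasSum_exp_neg_abs_mul_cexp hμ (k i)).summable.norm
  have h := Complex.hasSum_re
    (HasSum.prod_pi_fin (fun i => hasSum_exp_neg_abs_mul_cexp hμ (k i)) hnorm).1
  rw [← Complex.ofReal_prod, Complex.ofReal_re] at h
  convert h using 2 with x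
  rw [Finset.prod_mul_distrib, ← Complex.ofReal_prod, ← exp_sum, ← Complex.exp_sum,
    Complex.re_ofReal_mul, ← Finset.sum_mul, ← Finset.mul_sum, l1norm]
  have : (∑ i, (k i : ℂ) * ((x i : ℤ) : ℂ)) = ((∑ i, k i * (x i : ℝ) : ℝ) : ℂ) := by
    push_cast; rfl
  rw [this, Complex.exp_ofReal_mul_I_re]

lemma poissonSum_den_pos {μ : ℝ} (hμ : 0 < μ) (θ : ℝ) :
    0 < 1 - 2 * exp (-μ) * cos θ + exp (-μ) ^ 2 := by
  have h1 : exp (-μ) < 1 := by simpa using hμ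
  nlinarith [cos_le_one θ, exp_pos (-μ)]

lemma poissonSum_pos {μ : ℝ} (hμ : 0 < μ) (θ : ℝ) : 0 < poissonSum μ θ := by
  have h1 : exp (-μ) < 1 := by simpa using hμ
  exact div_pos (by nlinarith [exp_pos (-μ)]) (poissonSum_den_pos hμ θ)

lemma poissonSum_zero {μ : ℝ} (hμ : 0 < μ) :
    poissonSum μ 0 = (1 + exp (-μ)) / (1 - exp (-μ)) := by
  have h1 : 0 < 1 - exp (-μ) := by simpa using hμ
  have h2 := poissonSum_den_pos hμ 0
  unfold poissonSum
  rw [div_eq_div_iff h2.ne' h1.ne', cos_zero]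
  ring

lemma one_lt_poissonSum_zero {μ : ℝ} (hμ : 0 < μ) : 1 < poissonSum μ 0 := by
  have h1 : 0 < 1 - exp (-μ) := by simpa using hμ
  rw [poissonSum_zero hμ, one_lt_div h1]
  linarith [exp_pos (-μ)]

lemma poissonSum_le_zero {μ : ℝ} (hμ : 0 < μ) (θ : ℝ) : poissonSum μ θ ≤ poissonSum μ 0 := by
  have h1 : exp (-μ) < 1 := by simpa using hμ
  have := poissonSum_den_pos hμ 0
  unfold poissonSum
  refine div_le_div_of_nonneg_left (by nlinarith [exp_pos (-μ)]) this ?_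
  rw [cos_zero]
  nlinarith [cos_le_one θ, exp_pos (-μ)]

lemma tendsto_poissonSum_zero : Tendsto (fun μ => poissonSum μ 0) (𝓝[>] 0) atTop := by
  have hexp : Tendsto (fun μ : ℝ => exp (-μ)) (𝓝[>] 0) (𝓝 1) := by
    have : Continuous fun μ : ℝ => exp (-μ) := by fun_prop
    simpa using (this.tendsto 0).mono_left nhdsWithin_le_nhds
  have hden : Tendsto (fun μ : ℝ => 1 - exp (-μ)) (𝓝[>] 0) (𝓝[>] 0) := by
    refine tendsto_nhdsWithin_iff.2 ⟨by simpa using hexp.const_sub 1, ?_⟩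
    filter_upwards [self_mem_nhdsWithin] with μ hμ
    simpa using hμ
  refine ((hexp.const_add 1).pos_mul_atTop (by norm_num) hden.inv_tendsto_nhdsGT_zero).congr' ?_
  filter_upwards [self_mem_nhdsWithin] with μ hμ
  rw [poissonSum_zero hμ, div_eq_mul_inv]; rfl

lemma one_lt_poissonSum_zero_pow {μ : ℝ} (hμ : 0 < μ) {d : ℕ} (hd : d ≠ 0) :
    1 < poissonSum μ 0 ^ d :=
  one_lt_pow₀ (one_lt_poissonSum_zero hμ) hd

lemma hasSum_ite_exp_mul_cos {d : ℕ} {μ : ℝ} (hμ : 0 < μ) (k : Fin d → ℝ) :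
    HasSum (fun x : Fin d → ℤ =>
      (if x = 0 then 0 else exp (-μ * l1norm x)) * cos (∑ i, k i * (x i : ℝ)))
      (∏ i, poissonSum μ (k i) - 1) := by
  refine ((hasSum_exp_neg_l1norm_mul_cos hμ k).sub
    (hasSum_ite_eq (0 : Fin d → ℤ) (1 : ℝ))).congr_fun fun x => ?_
  by_cases hx : x = 0 <;> simp [hx, l1norm]

lemma tsum_ite_exp {d : ℕ} {μ : ℝ} (hμ : 0 < μ) :
    ∑' x : Fin d → ℤ, (if x = 0 then 0 else exp (-μ * l1norm x)) = poissonSum μ 0 ^ d - 1 := by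
  simpa using (hasSum_ite_exp_mul_cos hμ (0 : Fin d → ℝ)).tsum_eq

lemma yukawa_eq {d : ℕ} {μ : ℝ} (hμ : 0 < μ) (x : Fin d → ℤ) :
    yukawa d μ x =
      (poissonSum μ 0 ^ d - 1)⁻¹ * (if x = 0 then 0 else exp (-μ * l1norm x)) := by
  rw [yukawa, tsum_ite_exp hμ]
  split_ifs <;> simp

lemma hasSum_yukawa_mul_cos {d : ℕ} {μ : ℝ} (hμ : 0 < μ) (k : Fin d → ℝ) :
    HasSum (fun x => yukawa d μ x * cos (∑ i, k i * (x i : ℝ)))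
      ((∏ i, poissonSum μ (k i) - 1) / (poissonSum μ 0 ^ d - 1)) := by
  simp only [yukawa_eq hμ, mul_assoc, div_eq_inv_mul]
  exact (hasSum_ite_exp_mul_cos hμ k).mul_left _

lemma jhat_yukawa {d : ℕ} {μ : ℝ} (hμ : 0 < μ) (k : Fin d → ℝ) :
    jhat d (yukawa d μ) k =
      (∏ i, poissonSum μ (k i) - 1) / (poissonSum μ 0 ^ d - 1) :=
  (hasSum_yukawa_mul_cos hμ k).tsum_eq

lemma hasSum_yukawa {d : ℕ} (hd : d ≠ 0) {μ : ℝ} (hμ : 0 < μ) : HasSum (yukawa d μ) 1 := by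
  have h := hasSum_yukawa_mul_cos hμ (0 : Fin d → ℝ)
  have h1 := one_lt_poissonSum_zero_pow hμ hd
  simpa [div_self (sub_pos.2 h1).ne'] using h

lemma yukawa_nonneg {d : ℕ} (hd : d ≠ 0) {μ : ℝ} (hμ : 0 < μ) (x : Fin d → ℤ) :
    0 ≤ yukawa d μ x := by
  have h1 := sub_pos.2 (one_lt_poissonSum_zero_pow hμ hd)
  rw [yukawa_eq hμ]
  split_ifs <;> positivity

lemma yukawa_le {d : ℕ} (hd : d ≠ 0) {μ : ℝ} (hμ : 0 < μ) (x : Fin d → ℤ) :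
    yukawa d μ x ≤ (poissonSum μ 0 ^ d - 1)⁻¹ := by
  have h1 := sub_pos.2 (one_lt_poissonSum_zero_pow hμ hd)
  rw [yukawa_eq hμ]
  refine mul_le_of_le_one_right (by positivity) ?_
  split_ifs
  · exact zero_le_one
  · have : 0 ≤ l1norm x := Finset.sum_nonneg fun _ _ => abs_nonneg _
    rw [exp_le_one_iff]
    nlinarith

lemma abs_jhat_yukawa_le_one {d : ℕ} (hd : d ≠ 0) {μ : ℝ} (hμ : 0 < μ) (k : Fin d → ℝ) :
    |jhat d (yukawa d μ) k| ≤ 1 := by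
  have hJ := hasSum_yukawa hd hμ
  rw [← Real.norm_eq_abs]
  refine tsum_of_norm_bounded hJ fun x => ?_
  rw [norm_mul, Real.norm_of_nonneg (yukawa_nonneg hd hμ x)]
  exact mul_le_of_le_one_right (yukawa_nonneg hd hμ x) (abs_cos_le_one _)

lemma tendsto_inv_poissonSum_zero_pow_sub_one {d : ℕ} (hd : d ≠ 0) :
    Tendsto (fun μ => (poissonSum μ 0 ^ d - 1)⁻¹) (𝓝[>] 0) (𝓝 0) :=
  (tendsto_atTop_add_const_right _ (-1)
    ((tendsto_pow_atTop hd).comp tendsto_poissonSum_zero)).inv_tendsto_atTop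

lemma tendsto_tsum_yukawa_sq {d : ℕ} (hd : d ≠ 0) :
    Tendsto (fun μ => ∑' x : Fin d → ℤ, yukawa d μ x ^ 2) (𝓝[>] (0 : ℝ)) (𝓝 0) := by
  refine tendsto_of_tendsto_of_tendsto_of_le_of_le' tendsto_const_nhds
    (tendsto_inv_poissonSum_zero_pow_sub_one hd) (.of_forall fun μ => tsum_nonneg fun x =>
      sq_nonneg _) ?_
  filter_upwards [self_mem_nhdsWithin] with μ hμ
  have hb := (hasSum_yukawa hd hμ).mul_left (poissonSum μ 0 ^ d - 1)⁻¹
  rw [mul_one] at hb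
  refine tsum_le_of_sum_le' (by simpa using (yukawa_nonneg hd hμ 0).trans (yukawa_le hd hμ 0))
    fun s => (Finset.sum_le_sum fun x _ => ?_).trans (sum_le_hasSum s (fun x _ => ?_) hb)
  · rw [sq]
    exact mul_le_mul_of_nonneg_right (yukawa_le hd hμ x) (yukawa_nonneg hd hμ x)
  · exact mul_nonneg ((yukawa_nonneg hd hμ x).trans (yukawa_le hd hμ x)) (yukawa_nonneg hd hμ x)

lemma prod_poissonSum_le {d : ℕ} {μ : ℝ} (hμ : 0 < μ) (k : Fin d → ℝ) (j : Fin d) :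
    ∏ i, poissonSum μ (k i) ≤ poissonSum μ 0 ^ d * (poissonSum μ (k j) / poissonSum μ 0) := by
  have h0 := poissonSum_pos hμ 0
  have h : ∏ i ∈ Finset.univ.erase j, poissonSum μ (k i) ≤ poissonSum μ 0 ^ (d - 1) := by
    refine (Finset.prod_le_prod (fun i _ => (poissonSum_pos hμ _).le)
      fun i _ => poissonSum_le_zero hμ (k i)).trans_eq ?_
    simp
  calc ∏ i, poissonSum μ (k i)
      = (∏ i ∈ Finset.univ.erase j, poissonSum μ (k i)) * poissonSum μ (k j) :=
        (Finset.prod_erase_mul _ _ (Finset.mem_univ j)).symm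
    _ ≤ poissonSum μ 0 ^ (d - 1) * poissonSum μ (k j) :=
        mul_le_mul_of_nonneg_right h (poissonSum_pos hμ _).le
    _ = _ := by
        rw [← pow_sub_one_mul j.pos.ne' (poissonSum μ 0)]
        field_simp

/-- Each coordinate of `k` bounds `1 - Ĵ_μ(k)` from below. -/
lemma one_sub_div_le_one_sub_jhat {d : ℕ} (hd : d ≠ 0) {μ : ℝ} (hμ : 0 < μ) (k : Fin d → ℝ)
    (j : Fin d) :
    1 - poissonSum μ (k j) / poissonSum μ 0 ≤ 1 - jhat d (yukawa d μ) k := by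
  have h1 := one_lt_poissonSum_zero_pow hμ hd
  have h2 := prod_poissonSum_le hμ k j
  have h3 : poissonSum μ (k j) / poissonSum μ 0 ≤ 1 :=
    div_le_one_of_le₀ (poissonSum_le_zero hμ _) (poissonSum_pos hμ 0).le
  rw [jhat_yukawa hμ, sub_le_sub_iff_left, div_le_iff₀ (sub_pos.2 h1)]
  linarith

lemma poissonSum_div_zero {μ : ℝ} (hμ : 0 < μ) (θ : ℝ) :
    poissonSum μ θ / poissonSum μ 0 =
      (1 - exp (-μ)) ^ 2 / (1 - 2 * exp (-μ) * cos θ + exp (-μ) ^ 2) := by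
  have h1 : 0 < 1 - exp (-μ) := by simpa using hμ
  have h2 := poissonSum_den_pos hμ θ
  have h3 := exp_pos (-μ)
  rw [poissonSum_zero hμ, poissonSum]
  field_simp
  ring

lemma sq_le_one_sub_poissonSum_div {μ : ℝ} (hμ : 0 < μ) (hμ1 : μ ≤ 1) {θ : ℝ} (hθ : |θ| ≤ π) :
    exp (-1) / π ^ 2 * θ ^ 2 ≤ 1 - poissonSum μ θ / poissonSum μ 0 := by
  have h1 : exp (-μ) < 1 := by simpa using hμ
  have h2 : exp (-1) ≤ exp (-μ) := exp_le_exp.2 (by linarith)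
  have h3 := poissonSum_den_pos hμ θ
  have h4 := cos_le_one_sub_mul_cos_sq hθ
  have h5 : exp (-1) / π ^ 2 * θ ^ 2 = exp (-1) / 2 * (2 / π ^ 2 * θ ^ 2) := by ring
  have h6 : 0 ≤ 2 / π ^ 2 * θ ^ 2 := by positivity
  have h7 : exp (-1) / 2 * (2 / π ^ 2 * θ ^ 2) ≤ exp (-μ) / 2 * (1 - cos θ) :=
    mul_le_mul (by linarith) (by linarith) h6 (by positivity)
  have h8 : 0 ≤ exp (-μ) * (1 - cos θ) :=
    mul_nonneg (exp_pos _).le (by linarith [cos_le_one θ])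
  rw [h5, poissonSum_div_zero hμ, one_sub_div h3.ne', le_div_iff₀ h3]
  have h9 : 1 - 2 * exp (-μ) * cos θ + exp (-μ) ^ 2 ≤ 4 := by
    nlinarith [neg_one_le_cos θ, exp_pos (-μ)]
  calc _ ≤ exp (-μ) / 2 * (1 - cos θ) * 4 := mul_le_mul h7 h9 h3.le (by linarith)
    _ = _ := by ring

lemma abs_le_pi_of_mem_brillouin {d : ℕ} {k : Fin d → ℝ} (hk : k ∈ brillouin d) (i : Fin d) :
    |k i| ≤ π :=
  abs_le.2 ⟨hk.1 i, hk.2 i⟩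

lemma sq_le_one_sub_jhat {d : ℕ} {μ : ℝ} (hμ : 0 < μ) (hμ1 : μ ≤ 1) {k : Fin d → ℝ}
    (hk : k ∈ brillouin d) (j : Fin d) :
    exp (-1) / π ^ 2 * k j ^ 2 ≤ 1 - jhat d (yukawa d μ) k :=
  (sq_le_one_sub_poissonSum_div hμ hμ1 (abs_le_pi_of_mem_brillouin hk j)).trans
    (one_sub_div_le_one_sub_jhat j.pos.ne' hμ k j)

lemma sum_sq_le_one_sub_jhat {d : ℕ} (hd : d ≠ 0) {μ : ℝ} (hμ : 0 < μ) (hμ1 : μ ≤ 1)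
    {k : Fin d → ℝ} (hk : k ∈ brillouin d) :
    exp (-1) / π ^ 2 / d * ∑ i, k i ^ 2 ≤ 1 - jhat d (yukawa d μ) k := by
  have hd' : (0 : ℝ) < d := by positivity
  rw [div_mul_eq_mul_div, Finset.mul_sum, div_le_iff₀ hd']
  refine (Finset.sum_le_card_nsmul _ _ _ fun j _ => sq_le_one_sub_jhat hμ hμ1 hk j).trans_eq ?_
  simp [mul_comm]

lemma tendsto_jhat_yukawa {d : ℕ} {k : Fin d → ℝ} (hk : k ∈ brillouin d) (hk0 : k ≠ 0) :
    Tendsto (fun μ => jhat d (yukawa d μ) k) (𝓝[>] 0) (𝓝 0) := by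
  obtain ⟨j, hj⟩ := Function.ne_iff.1 hk0
  have hd : d ≠ 0 := j.pos.ne'
  have hcos : cos (k j) < 1 := by
    have h := cos_le_one_sub_mul_cos_sq (abs_le_pi_of_mem_brillouin hk j)
    have : 0 < 2 / π ^ 2 * k j ^ 2 := by
      have : k j ≠ 0 := hj
      positivity
    linarith
  have hq : Tendsto (fun μ => poissonSum μ (k j) / poissonSum μ 0) (𝓝[>] 0) (𝓝 0) := by
    have hc : ContinuousAt (fun μ : ℝ =>
        (1 - exp (-μ)) ^ 2 / (1 - 2 * exp (-μ) * cos (k j) + exp (-μ) ^ 2)) 0 := by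
      refine ContinuousAt.div (by fun_prop) (by fun_prop) ?_
      simp only [neg_zero, exp_zero]
      linarith
    have hc' := hc.tendsto.mono_left (nhdsWithin_le_nhds (s := Ioi 0))
    simp only [neg_zero, exp_zero, sub_self, ne_eq, OfNat.ofNat_ne_zero, not_false_eq_true,
      zero_pow, zero_div] at hc'
    refine hc'.congr' ?_
    filter_upwards [self_mem_nhdsWithin] with μ hμ
    rw [poissonSum_div_zero hμ]
  have hZ := tendsto_inv_poissonSum_zero_pow_sub_one hd
  refine tendsto_of_tendsto_of_tendsto_of_le_of_le' (by simpa using hZ.neg) hq ?_ ?_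
  · filter_upwards [self_mem_nhdsWithin] with μ hμ
    have h1 := sub_pos.2 (one_lt_poissonSum_zero_pow hμ hd)
    have h2 : 0 ≤ ∏ i, poissonSum μ (k i) :=
      Finset.prod_nonneg fun i _ => (poissonSum_pos hμ _).le
    rw [jhat_yukawa hμ, div_eq_mul_inv, neg_eq_neg_one_mul]
    exact mul_le_mul_of_nonneg_right (by linarith) (inv_pos.2 h1).le
  · filter_upwards [self_mem_nhdsWithin] with μ hμ
    linarith [one_sub_div_le_one_sub_jhat hd hμ k j]

lemma brillouin_eq_closedBall (d : ℕ) : brillouin d = Metric.closedBall 0 π := by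
  ext k
  rw [mem_closedBall_zero_iff, pi_norm_le_iff_of_nonneg pi_pos.le]
  simp [brillouin, Pi.le_def, abs_le, forall_and]

lemma integrableOn_inv_norm_sq {E : Type*} [NormedAddCommGroup E] [NormedSpace ℝ E]
    [FiniteDimensional ℝ E] [MeasurableSpace E] [BorelSpace E] (ν : Measure E)
    [ν.IsAddHaarMeasure] (hE : 3 ≤ Module.finrank ℝ E) (r : ℝ) :
    IntegrableOn (fun x : E => (‖x‖ ^ 2)⁻¹) (Metric.ball 0 r) ν := by
  have : Nontrivial E := Module.nontrivial_of_finrank_pos (R := ℝ) (by omega)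
  rw [integrableOn_fun_norm_addHaar ν (f := fun y : ℝ => (y ^ 2)⁻¹)]
  have hc : IntegrableOn (fun y : ℝ => y ^ (Module.finrank ℝ E - 3)) (Ioo 0 r) :=
    ((continuous_pow _).integrableOn_Icc).mono_set Ioo_subset_Icc_self
  refine hc.congr_fun (fun y hy => ?_) measurableSet_Ioo
  have hy0 : y ≠ 0 := hy.1.ne'
  obtain ⟨m, hm⟩ := Nat.exists_eq_add_of_le hE
  simp only [hm, smul_eq_mul]
  rw [show 3 + m - 1 = m + 2 by omega, show 3 + m - 3 = m by omega, pow_add]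
  field_simp

lemma tendsto_irIntegral_yukawa {d : ℕ} (hd : 3 ≤ d) :
    Tendsto (fun μ => irIntegral d (yukawa d μ)) (𝓝[>] (0 : ℝ)) (𝓝 0) := by
  have hd0 : d ≠ 0 := by omega
  have : NeZero d := ⟨hd0⟩
  set c : ℝ := exp (-1) / π ^ 2
  have hc0 : 0 < c := by positivity
  have hmeas : MeasurableSet (brillouin d) := measurableSet_Icc
  suffices h : Tendsto (fun μ => ∫ k in brillouin d,
      jhat d (yukawa d μ) k ^ 2 / (1 - jhat d (yukawa d μ) k)) (𝓝[>] 0)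
      (𝓝 (∫ _ in brillouin d, (0 : ℝ))) by
    simpa [irIntegral] using h.const_mul (1 / (2 * π) ^ d)
  have hne : ∀ᵐ k ∂(volume.restrict (brillouin d)), k ≠ 0 :=
    ae_restrict_of_ae (Measure.ae_ne volume 0)
  refine tendsto_integral_filter_of_dominated_convergence (fun k => c⁻¹ * (‖k‖ ^ 2)⁻¹)
    ?_ ?_ ?_ ?_
  · filter_upwards [self_mem_nhdsWithin] with μ hμ
    have hj : Measurable (jhat d (yukawa d μ)) := by
      rw [funext fun k => jhat_yukawa hμ k]
      unfold poissonSum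
      fun_prop
    exact ((hj.pow_const 2).div (hj.const_sub 1)).aestronglyMeasurable
  · filter_upwards [Ioc_mem_nhdsGT zero_lt_one] with μ ⟨hμ, hμ1⟩
    filter_upwards [hne, ae_restrict_mem hmeas] with k hk0 hk
    obtain ⟨j, hj⟩ : ∃ j, ‖k‖ = ‖k j‖ := by
      obtain ⟨j, -, hj⟩ := Finset.exists_mem_eq_sup Finset.univ Finset.univ_nonempty
        fun i => ‖k i‖₊
      exact ⟨j, congrArg NNReal.toReal hj⟩
    have hlow : c * ‖k‖ ^ 2 ≤ 1 - jhat d (yukawa d μ) k := by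
      rw [hj, Real.norm_eq_abs, sq_abs]
      exact sq_le_one_sub_jhat hμ hμ1 hk j
    have hpos : 0 < c * ‖k‖ ^ 2 := by positivity
    have hle := abs_jhat_yukawa_le_one hd0 hμ k
    rw [Real.norm_of_nonneg (div_nonneg (sq_nonneg _) (hpos.le.trans hlow)), ← mul_inv,
      ← one_div]
    exact div_le_div₀ zero_le_one ((sq_le_one_iff_abs_le_one _).2 hle) hpos hlow
  · refine Integrable.const_mul ?_ _
    rw [brillouin_eq_closedBall]
    exact (integrableOn_inv_norm_sq volume (by simpa using hd) (π + 1)).mono_set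
      (Metric.closedBall_subset_ball (by linarith))
  · filter_upwards [hne, ae_restrict_mem hmeas] with k hk0 hk
    have h := tendsto_jhat_yukawa hk hk0
    simpa [Pi.div_def] using (h.pow 2).div (h.const_sub 1) (by simp)

/-- Infrared bounds for the Yukawa interactions (Lemma 4.8). -/
theorem yukawa_ir_bounds (d : ℕ) (hd : 1 ≤ d) :
    -- normalization: the `J_μ` are indeed probability kernels
    (∀ μ : ℝ, 0 < μ → Summable (yukawa d μ) ∧ ∑' x, yukawa d μ x = 1) ∧
    -- (1) `1 - Ĵ_μ(k) ≥ C |k|²` uniformly in small `μ`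
    (∃ C : ℝ, 0 < C ∧ ∃ μ₀ : ℝ, 0 < μ₀ ∧ ∀ μ : ℝ, 0 < μ → μ ≤ μ₀ →
      ∀ k ∈ brillouin d, C * (∑ i, k i ^ 2) ≤ 1 - jhat d (yukawa d μ) k) ∧
    -- (2) the ℓ² norm vanishes as `μ ↓ 0`
    Tendsto (fun μ => ∑' x : Fin d → ℤ, yukawa d μ x ^ 2) (𝓝[>] (0 : ℝ)) (𝓝 0) ∧
    -- hence in dimensions `d ≥ 3` the infrared integral vanishes as `μ ↓ 0`
    (3 ≤ d → Tendsto (fun μ => irIntegral d (yukawa d μ)) (𝓝[>] (0 : ℝ)) (𝓝 0)) := by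
  have hd0 : d ≠ 0 := by omega
  refine ⟨fun μ hμ => ⟨(hasSum_yukawa hd0 hμ).summable, (hasSum_yukawa hd0 hμ).tsum_eq⟩,
    ⟨exp (-1) / π ^ 2 / d, by positivity, 1, one_pos, fun μ hμ hμ1 k hk =>
      sum_sq_le_one_sub_jhat hd0 hμ hμ1 hk⟩,
    tendsto_tsum_yukawa_sq hd0, tendsto_irIntegral_yukawa⟩
end
end

section
/- Let d ≥ 1 and for each s > d define J_s : ℤ^d → ℝ by J_s(0) = 0 and J_s(x) = c_s |x|₁^{−s} for x ≠ 0, where |x|₁ = Σ_{i=1}^{d} |x_i| and c_s > 0 is chosen so that Σ_{x ∈ ℤ^d} J_s(x) = 1. Let Ĵ_s(k) = Σ_{x ∈ ℤ^d} J_s(x) e^{i k·x}. Then: (1) for every δ with 0 < δ < d there exist C > 0 and s₀ > d such that 1 − Ĵ_s(k) ≥ C |k|^{d−δ} for all d < s ≤ s₀ and all k ∈ [−π, π]^d \ {0}, where |k| is the Euclidean norm; (2) Σ_{x ∈ ℤ^d} J_s(x)² → 0 as s ↓ d. Consequently, for every d ≥ 1, ∫_{[−π,π]^d} Ĵ_s(k)²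 / (1 − Ĵ_s(k)) dk/(2π)^d → 0 as s ↓ d. -/
open Real Set Filter Topology MeasureTheory

noncomputable section

/-- The normalized power-law interaction `J_s(x) = c_s |x|₁^{-s}` for `x ≠ 0`,
`J_s(0) = 0`, with `c_s` chosen so that `Σ_x J_s(x) = 1`. -/
noncomputable def powerlaw (d : ℕ) (s : ℝ) (x : Fin d → ℤ) : ℝ :=
  if x = 0 then 0 else
    (∑' y : Fin d → ℤ, if y = 0 then (0 : ℝ) else l1norm y ^ (-s))⁻¹ * l1norm x ^ (-s)

theorem norm_geom_sum_exp_le {n : ℕ} {t : ℝ} (ht : |t| ≤ π) (hn : 2 * π ≤ n * |t|) :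
    ‖∑ r : Fin n, Complex.exp (Complex.I * (t * (r : ℕ) : ℝ))‖ ≤ n / 2 := by
  have h0 : 0 < |t| := by
    by_contra h
    have : |t| = 0 := le_antisymm (not_lt.1 h) (abs_nonneg t)
    rw [this] at hn
    linarith [pi_pos]
  have hsum : ∑ r : Fin n, Complex.exp (Complex.I * (t * (r : ℕ) : ℝ)) =
      ∑ r ∈ Finset.range n, Complex.exp (Complex.I * t) ^ r := by
    rw [Finset.sum_range]
    refine Finset.sum_congr rfl fun r _ => ?_
    rw [← Complex.exp_nat_mul]
    congr 1
    push_cast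
    ring
  have hgeom := congrArg norm (geom_sum_mul (Complex.exp (Complex.I * t)) n)
  rw [norm_mul, ← hsum, Complex.norm_exp_I_mul_ofReal_sub_one] at hgeom
  have hz : ‖Complex.exp (Complex.I * t) ^ n‖ = 1 := by
    rw [norm_pow, Complex.norm_exp_I_mul_ofReal, one_pow]
  have h2 : ‖Complex.exp (Complex.I * t) ^ n - 1‖ ≤ 2 := by
    refine (norm_sub_le _ _).trans ?_
    rw [hz, norm_one]
    norm_num
  have hsin : 2 / π * |t / 2| ≤ |Real.sin (t / 2)| := by
    apply mul_abs_le_abs_sin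
    rw [abs_div, abs_two]
    linarith
  rw [norm_mul, Real.norm_ofNat, Real.norm_eq_abs] at hgeom
  set S := ‖∑ r : Fin n, Complex.exp (Complex.I * (t * (r : ℕ) : ℝ))‖
  have hS : 0 ≤ S := norm_nonneg _
  have h3 : S * (2 * (2 / π * |t / 2|)) ≤ 2 :=
    (by gcongr : _ ≤ S * (2 * |Real.sin (t / 2)|)).trans (hgeom.le.trans h2)
  have h4 : S * (2 * (2 / π * |t / 2|)) = 2 * (S * |t|) / π := by
    rw [abs_div, abs_two]
    ring
  rw [h4, div_le_iff₀ pi_pos] at h3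
  have h5 : S * |t| ≤ n / 2 * |t| := by linarith
  exact le_of_mul_le_mul_right h5 h0

theorem half_card_le_sum_one_sub_cos {d n : ℕ} {k : Fin d → ℝ} {j : Fin d} (hk : |k j| ≤ π)
    (hn : 2 * π ≤ n * |k j|) (θ : ℝ) :
    (n : ℝ) ^ d / 2 ≤
      ∑ r : Fin d → Fin n, (1 - Real.cos (θ + ∑ i, k i * ((r i : ℕ) : ℝ))) := by
  have hcos : ∑ r : Fin d → Fin n, Real.cos (θ + ∑ i, k i * ((r i : ℕ) : ℝ)) =
      (Complex.exp (Complex.I * θ) *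
        ∏ i, ∑ r : Fin n, Complex.exp (Complex.I * (k i * (r : ℕ) : ℝ))).re := by
    rw [Fintype.prod_sum, Finset.mul_sum, Complex.re_sum]
    refine Finset.sum_congr rfl fun r _ => ?_
    rw [← Complex.exp_sum, ← Complex.exp_add, ← Complex.exp_ofReal_mul_I_re]
    congr 2
    push_cast
    rw [← Finset.mul_sum]
    ring
  have hle : ∑ r : Fin d → Fin n, Real.cos (θ + ∑ i, k i * ((r i : ℕ) : ℝ)) ≤
      (n : ℝ) ^ d / 2 := by
    rw [hcos]
    refine (Complex.re_le_norm _).trans ?_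
    rw [norm_mul, Complex.norm_exp_I_mul_ofReal, one_mul, norm_prod]
    calc ∏ i, ‖∑ r : Fin n, Complex.exp (Complex.I * (k i * (r : ℕ) : ℝ))‖
        ≤ ∏ i : Fin d, ((n : ℝ) * if i = j then 1 / 2 else 1) := by
          refine Finset.prod_le_prod (fun _ _ => norm_nonneg _) fun i _ => ?_
          split_ifs with h
          · subst h
            exact (norm_geom_sum_exp_le hk hn).trans_eq (by ring)
          · refine (norm_sum_le _ _).trans ?_
            simp only [Complex.norm_exp_I_mul_ofReal]
            simp
      _ = (n : ℝ) ^ d / 2 := by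
          rw [Finset.prod_mul_distrib, Finset.prod_ite_eq']
          simp
          ring
  rw [Finset.sum_sub_distrib]
  simp only [Finset.sum_const, Finset.card_univ, Fintype.card_pi, Fintype.card_fin,
    Finset.prod_const, nsmul_eq_mul, mul_one]
  push_cast
  linarith

theorem l1norm_nonneg {d : ℕ} (x : Fin d → ℤ) : 0 ≤ l1norm x :=
  Finset.sum_nonneg fun _ _ => abs_nonneg _

theorem abs_le_l1norm {d : ℕ} (x : Fin d → ℤ) (i : Fin d) : |(x i : ℝ)| ≤ l1norm x :=
  Finset.single_le_sum (f := fun i => |(x i : ℝ)|) (fun _ _ => abs_nonneg _) (Finset.mem_univ i)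

theorem one_le_l1norm {d : ℕ} {x : Fin d → ℤ} (hx : x ≠ 0) : 1 ≤ l1norm x := by
  obtain ⟨i, hi⟩ := Function.ne_iff.1 hx
  refine le_trans ?_ (abs_le_l1norm x i)
  exact_mod_cast Int.one_le_abs hi

theorem l1norm_zero {d : ℕ} : l1norm (0 : Fin d → ℤ) = 0 := by
  simp [l1norm]

theorem summable_l1norm_rpow {d : ℕ} {s : ℝ} (hs : (d : ℝ) < s) :
    Summable fun x : Fin d → ℤ => l1norm x ^ (-s) := by
  have hs0 : 0 < s := lt_of_le_of_lt (Nat.cast_nonneg d) hs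
  let L := Submodule.span ℤ (Set.range (Pi.basisFun ℝ (Fin d)))
  have hrank : Module.finrank ℤ L = d := by
    rw [ZLattice.rank ℝ L]
    simp
  have hmem (x : Fin d → ℤ) : (fun i => (x i : ℝ)) ∈ L := by
    rw [(Pi.basisFun ℝ (Fin d)).mem_span_iff_repr_mem ℤ]
    intro i
    exact ⟨x i, by simp⟩
  have hL := ZLattice.summable_norm_rpow L (-s) (by rw [hrank]; linarith)
  have hinj : Function.Injective fun x : Fin d → ℤ => (⟨fun i => (x i : ℝ), hmem x⟩ : L) := by
    intro x y h
    funext i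
    exact Int.cast_injective (α := ℝ) (congrFun (congrArg Subtype.val h) i)
  refine (hL.comp_injective hinj).of_nonneg_of_le
    (fun x => rpow_nonneg (l1norm_nonneg x) _) fun x => ?_
  rcases eq_or_ne x 0 with rfl | hx
  · rw [l1norm_zero, zero_rpow (by linarith)]
    exact rpow_nonneg (norm_nonneg _) _
  · apply rpow_le_rpow_of_nonpos
    · rw [norm_pos_iff]
      intro h
      refine hx (hinj (h.trans ?_))
      ext i
      simp
    · change ‖fun i => (x i : ℝ)‖ ≤ _
      rw [pi_norm_le_iff_of_nonneg (l1norm_nonneg x)]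
      exact abs_le_l1norm x
    · linarith

/-- Division with remainder by `n` in every coordinate. -/
def blockEquiv (d n : ℕ) [NeZero n] :
    (Fin d → ℤ) ≃ (Fin d → ℤ) × (Fin d → Fin n) :=
  (Equiv.arrowCongr (Equiv.refl _) (Int.divModEquiv n)).trans
    (Equiv.arrowProdEquivProdArrow (Fin d) (fun _ => ℤ) (fun _ => Fin n))

theorem blockEquiv_symm_apply {d n : ℕ} [NeZero n] (y : Fin d → ℤ) (r : Fin d → Fin n)
    (i : Fin d) : (blockEquiv d n).symm (y, r) i = y i * n + (r i : ℕ) := by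
  simp [blockEquiv, Equiv.arrowProdEquivProdArrow]

theorem hasSum_block {d n : ℕ} [NeZero n] {f : (Fin d → ℤ) → ℝ} (hf : Summable f) :
    HasSum (fun y => ∑ r, f ((blockEquiv d n).symm (y, r))) (∑' x, f x) :=
  ((blockEquiv d n).symm.hasSum_iff.2 hf.hasSum).prod_fiberwise fun _ => hasSum_fintype _

theorem blockEquiv_symm_ne_zero {d n : ℕ} [NeZero n] {y : Fin d → ℤ} (hy : y ≠ 0)
    (r : Fin d → Fin n) : (blockEquiv d n).symm (y, r) ≠ 0 := by
  intro h
  have h0 : (blockEquiv d n).symm (0, 0) = 0 := by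
    funext i
    simp [blockEquiv_symm_apply]
  exact hy (congrArg Prod.fst ((blockEquiv d n).symm.injective (h.trans h0.symm)))

theorem l1norm_blockEquiv_symm_le {d n : ℕ} [NeZero n] {y : Fin d → ℤ} (hy : y ≠ 0)
    (r : Fin d → Fin n) :
    l1norm ((blockEquiv d n).symm (y, r)) ≤ (1 + d) * n * l1norm y := by
  have h1 : l1norm ((blockEquiv d n).symm (y, r)) ≤ ∑ i, (|(y i : ℝ)| * n + n) := by
    refine Finset.sum_le_sum fun i _ => ?_
    rw [blockEquiv_symm_apply]
    push_cast
    refine (abs_add_le _ _).trans ?_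
    rw [abs_mul, Nat.abs_cast, Nat.abs_cast]
    gcongr
    exact (r i).is_lt.le
  rw [Finset.sum_add_distrib, ← Finset.sum_mul] at h1
  simp only [Finset.sum_const, Finset.card_univ, Fintype.card_fin, nsmul_eq_mul] at h1
  have h2 : (d : ℝ) * n * 1 ≤ d * n * l1norm y := by
    gcongr
    exact one_le_l1norm hy
  change _ ≤ l1norm y * n + d * n at h1
  linarith

theorem le_l1norm_blockEquiv_symm_rpow {d n : ℕ} [NeZero n] {s : ℝ} (hs : 0 < s)
    (y : Fin d → ℤ) (r : Fin d → Fin n) :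
    ((1 + d) * n : ℝ) ^ (-s) * l1norm y ^ (-s) ≤
      l1norm ((blockEquiv d n).symm (y, r)) ^ (-s) := by
  rcases eq_or_ne y 0 with rfl | hy
  · rw [l1norm_zero, zero_rpow (by linarith), mul_zero]
    exact rpow_nonneg (l1norm_nonneg _) _
  · rw [← mul_rpow (by positivity) (l1norm_nonneg y)]
    exact rpow_le_rpow_of_nonpos
      (one_pos.trans_le (one_le_l1norm (blockEquiv_symm_ne_zero hy r)))
      (l1norm_blockEquiv_symm_le hy r) (by linarith)

theorem powerlaw_eq {d : ℕ} {s : ℝ} (hs : 0 < s) (x : Fin d → ℤ) :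
    powerlaw d s x = (∑' y : Fin d → ℤ, l1norm y ^ (-s))⁻¹ * l1norm x ^ (-s) := by
  have h0 : l1norm (0 : Fin d → ℤ) ^ (-s) = 0 := by
    rw [l1norm_zero, zero_rpow (by linarith)]
  have h (y : Fin d → ℤ) : (if y = 0 then (0 : ℝ) else l1norm y ^ (-s)) = l1norm y ^ (-s) := by
    split_ifs with hy
    · rw [hy, h0]
    · rfl
  simp only [powerlaw, h]
  split_ifs with hx
  · rw [hx, h0, mul_zero]
  · rfl

theorem tsum_l1norm_rpow_pos {d : ℕ} (hd : 1 ≤ d) {s : ℝ} (hs : (d : ℝ) < s) :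
    0 < ∑' y : Fin d → ℤ, l1norm y ^ (-s) := by
  have hne : (fun _ => 1 : Fin d → ℤ) ≠ 0 := fun h => by simpa using congrFun h ⟨0, hd⟩
  exact (summable_l1norm_rpow hs).tsum_pos (fun x => rpow_nonneg (l1norm_nonneg x) _) _
    (rpow_pos_of_pos (one_pos.trans_le (one_le_l1norm hne)) _)

theorem hasSum_powerlaw {d : ℕ} (hd : 1 ≤ d) {s : ℝ} (hs : (d : ℝ) < s) :
    HasSum (powerlaw d s) 1 := by
  have hs0 : 0 < s := lt_of_le_of_lt (Nat.cast_nonneg d) hs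
  have h := (summable_l1norm_rpow hs).hasSum.mul_left (∑' y : Fin d → ℤ, l1norm y ^ (-s))⁻¹
  rw [inv_mul_cancel₀ (tsum_l1norm_rpow_pos hd hs).ne'] at h
  simpa only [← powerlaw_eq hs0] using h

theorem powerlaw_nonneg (d : ℕ) (s : ℝ) (x : Fin d → ℤ) : 0 ≤ powerlaw d s x := by
  have h (y : Fin d → ℤ) : 0 ≤ l1norm y ^ (-s) := rpow_nonneg (l1norm_nonneg y) _
  unfold powerlaw
  split_ifs
  · exact le_rfl
  · refine mul_nonneg (inv_nonneg.2 (tsum_nonneg fun y => ?_)) (h x)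
    split_ifs
    exacts [le_rfl, h y]

theorem powerlaw_le {d : ℕ} {s : ℝ} (hs : 0 < s) (x : Fin d → ℤ) :
    powerlaw d s x ≤ (∑' y : Fin d → ℤ, l1norm y ^ (-s))⁻¹ := by
  have hinv : 0 ≤ (∑' y : Fin d → ℤ, l1norm y ^ (-s))⁻¹ :=
    inv_nonneg.2 (tsum_nonneg fun y => rpow_nonneg (l1norm_nonneg y) _)
  rcases eq_or_ne x 0 with rfl | hx
  · simpa [powerlaw] using hinv
  · rw [powerlaw_eq hs]
    exact mul_le_of_le_one_right hinv
      (rpow_le_one_of_one_le_of_nonpos (one_le_l1norm hx) (by linarith))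

theorem powerlaw_neg (d : ℕ) (s : ℝ) (x : Fin d → ℤ) : powerlaw d s (-x) = powerlaw d s x := by
  simp [powerlaw, l1norm]

theorem summable_mul_cos {d : ℕ} {J : (Fin d → ℤ) → ℝ} (hJ : Summable J) (k : Fin d → ℝ) :
    Summable fun x : Fin d → ℤ => J x * Real.cos (∑ i, k i * (x i : ℝ)) := by
  refine hJ.abs.of_norm_bounded fun x => ?_
  rw [norm_mul, Real.norm_eq_abs, Real.norm_eq_abs]
  exact mul_le_of_le_one_right (abs_nonneg _) (abs_cos_le_one _)

theorem hasSum_one_sub_jhat {d : ℕ} {J : (Fin d → ℤ) → ℝ} (hJ : HasSum J 1) (k : Fin d → ℝ) :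
    HasSum (fun x : Fin d → ℤ => J x * (1 - Real.cos (∑ i, k i * (x i : ℝ))))
      (1 - jhat d J k) := by
  simpa only [mul_sub, mul_one, jhat] using hJ.sub (summable_mul_cos hJ.summable k).hasSum

theorem le_one_sub_jhat_powerlaw {d : ℕ} (hd : 1 ≤ d) {s : ℝ} (hs : (d : ℝ) < s) {n : ℕ}
    (hn0 : n ≠ 0) {k : Fin d → ℝ} {j : Fin d} (hk : |k j| ≤ π) (hn : 2 * π ≤ n * |k j|) :
    (1 + d : ℝ) ^ (-s) * (n : ℝ) ^ ((d : ℝ) - s) / 2 ≤ 1 - jhat d (powerlaw d s) k := by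
  have hs0 : 0 < s := lt_of_le_of_lt (Nat.cast_nonneg d) hs
  have : NeZero n := ⟨hn0⟩
  have hJ := hasSum_powerlaw hd hs
  have h := hasSum_one_sub_jhat hJ k
  have hblock := hasSum_block (n := n) h.summable
  rw [h.tsum_eq] at hblock
  have hn' : (0 : ℝ) < n := by exact_mod_cast Nat.pos_of_ne_zero hn0
  have hconst : ((1 + d) * n : ℝ) ^ (-s) * ((n : ℝ) ^ d / 2) =
      (1 + d : ℝ) ^ (-s) * (n : ℝ) ^ ((d : ℝ) - s) / 2 := by
    rw [mul_rpow (by positivity) hn'.le, sub_eq_add_neg (d : ℝ), rpow_add hn', rpow_natCast]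
    ring
  have h2 := hJ.mul_left ((1 + d : ℝ) ^ (-s) * (n : ℝ) ^ ((d : ℝ) - s) / 2)
  rw [mul_one] at h2
  refine hasSum_le (fun y => ?_) h2 hblock
  have hcos := half_card_le_sum_one_sub_cos hk hn (∑ i, k i * ((y i : ℝ) * n))
  have hpow (r : Fin d → Fin n) : ((1 + d) * n : ℝ) ^ (-s) * powerlaw d s y ≤
      powerlaw d s ((blockEquiv d n).symm (y, r)) := by
    rw [powerlaw_eq hs0, powerlaw_eq hs0, mul_left_comm]
    exact mul_le_mul_of_nonneg_left (le_l1norm_blockEquiv_symm_rpow hs0 y r)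
      (inv_nonneg.2 (tsum_nonneg fun y => rpow_nonneg (l1norm_nonneg y) _))
  calc (1 + d : ℝ) ^ (-s) * (n : ℝ) ^ ((d : ℝ) - s) / 2 * powerlaw d s y
      = ((1 + d) * n : ℝ) ^ (-s) * powerlaw d s y * ((n : ℝ) ^ d / 2) := by
        rw [← hconst]
        ring
    _ ≤ ((1 + d) * n : ℝ) ^ (-s) * powerlaw d s y * ∑ r : Fin d → Fin n,
          (1 - Real.cos (∑ i, k i * ((y i : ℝ) * n) + ∑ i, k i * ((r i : ℕ) : ℝ))) :=
        mul_le_mul_of_nonneg_left hcos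
          (mul_nonneg (by positivity) (powerlaw_nonneg d s y))
    _ ≤ _ := by
        rw [Finset.mul_sum]
        refine Finset.sum_le_sum fun r _ => ?_
        have harg : ∑ i, k i * (((blockEquiv d n).symm (y, r) i : ℤ) : ℝ) =
            ∑ i, k i * ((y i : ℝ) * n) + ∑ i, k i * ((r i : ℕ) : ℝ) := by
          rw [← Finset.sum_add_distrib]
          refine Finset.sum_congr rfl fun i _ => ?_
          rw [blockEquiv_symm_apply]
          push_cast
          ring
        rw [harg]
        exact mul_le_mul_of_nonneg_right (hpow r) (sub_nonneg.2 (cos_le_one _))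

theorem sqrt_sum_sq_le {d : ℕ} {k : Fin d → ℝ} {t : ℝ} (ht : 0 ≤ t) (hk : ∀ i, |k i| ≤ t) :
    Real.sqrt (∑ i, k i ^ 2) ≤ d * t := by
  rw [Real.sqrt_le_left (by positivity)]
  calc ∑ i, k i ^ 2 ≤ ∑ _i : Fin d, t ^ 2 :=
        Finset.sum_le_sum fun i _ => sq_le_sq' (abs_le.1 (hk i)).1 (abs_le.1 (hk i)).2
    _ = d * t ^ 2 := by simp
    _ ≤ (d * t) ^ 2 := by
        rw [mul_pow]
        gcongr
        exact_mod_cast Nat.le_self_pow two_ne_zero d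

theorem infrared_lower_bound {d : ℕ} (hd : 1 ≤ d) {δ : ℝ} (hδ : δ < d) :
    ∃ C : ℝ, 0 < C ∧ ∃ s₀ : ℝ, (d : ℝ) < s₀ ∧ ∀ s : ℝ, (d : ℝ) < s → s ≤ s₀ →
      ∀ k ∈ brillouin d, k ≠ 0 →
        C * Real.sqrt (∑ i, k i ^ 2) ^ ((d : ℝ) - δ) ≤ 1 - jhat d (powerlaw d s) k := by
  have hd' : (0 : ℝ) < d := by exact_mod_cast hd
  set a := (d : ℝ) - δ with ha
  have ha0 : 0 < a := sub_pos.2 hδ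
  have hπ := pi_pos
  refine ⟨(1 + d : ℝ) ^ (-(d + a)) * (3 * π * d) ^ (-a) / 2, by positivity, d + a, by linarith,
    fun s hs hs₀ k hk hk0 => ?_⟩
  have : Nonempty (Fin d) := ⟨⟨0, hd⟩⟩
  obtain ⟨j, hj⟩ := Finite.exists_max fun i => |k i|
  set t := |k j|
  have htπ : t ≤ π := abs_le.2 ⟨hk.1 j, hk.2 j⟩
  have ht : 0 < t := by
    obtain ⟨i, hi⟩ := Function.ne_iff.1 hk0
    exact (abs_pos.2 hi).trans_le (hj i)
  have hn1 : 2 * π / t ≤ ⌈2 * π / t⌉₊ := Nat.le_ceil _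
  have hn2 : (⌈2 * π / t⌉₊ : ℝ) ≤ 3 * π / t := by
    refine (Nat.ceil_lt_add_one (by positivity)).le.trans ?_
    have : 1 ≤ π / t := (one_le_div ht).2 htπ
    have h3 : 3 * π / t = 2 * π / t + π / t := by ring
    linarith
  set n := ⌈2 * π / t⌉₊
  have hnpos : (0 : ℝ) < n := lt_of_lt_of_le (by positivity) hn1
  refine le_trans ?_ (le_one_sub_jhat_powerlaw hd hs (by exact_mod_cast hnpos.ne') htπ
    ((div_le_iff₀ ht).1 hn1))
  have h1 : (1 + d : ℝ) ^ (-(d + a)) ≤ (1 + d : ℝ) ^ (-s) :=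
    rpow_le_rpow_of_exponent_le (by linarith) (by linarith)
  have h2 : (3 * π * d) ^ (-a) * Real.sqrt (∑ i, k i ^ 2) ^ a ≤ (n : ℝ) ^ ((d : ℝ) - s) := by
    calc (3 * π * d) ^ (-a) * Real.sqrt (∑ i, k i ^ 2) ^ a
        ≤ (3 * π * d) ^ (-a) * (d * t) ^ a := by
          gcongr
          exact sqrt_sum_sq_le ht.le hj
      _ = (3 * π / t) ^ (-a) := by
          rw [rpow_neg (by positivity), rpow_neg (by positivity),
            div_rpow (by positivity) ht.le, mul_rpow (by positivity) hd'.le,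
            mul_rpow hd'.le ht.le]
          have := (rpow_pos_of_pos hd' a).ne'
          have := (rpow_pos_of_pos ht a).ne'
          have : (3 * π) ^ a ≠ 0 := by positivity
          field_simp
      _ ≤ (3 * π / t) ^ ((d : ℝ) - s) := by
          refine rpow_le_rpow_of_exponent_le ?_ (by linarith)
          rw [one_le_div ht]
          linarith
      _ ≤ (n : ℝ) ^ ((d : ℝ) - s) := rpow_le_rpow_of_nonpos hnpos hn2 (by linarith)
  calc _ = (1 + d : ℝ) ^ (-(d + a)) * ((3 * π * d) ^ (-a) * Real.sqrt (∑ i, k i ^ 2) ^ a) / 2 := by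
        ring
    _ ≤ _ := by gcongr

theorem not_summable_l1norm_rpow {d : ℕ} (hd : 1 ≤ d) :
    ¬ Summable fun x : Fin d → ℤ => l1norm x ^ (-(d : ℝ)) := by
  intro h
  have hd' : (0 : ℝ) < d := by exact_mod_cast hd
  let y : Fin d → ℤ := fun _ => 1
  have hy : l1norm y = d := by simp [l1norm, y]
  obtain ⟨F, hF⟩ := summable_iff_vanishing_norm.1 h
    ((1 + d : ℝ) ^ (-(d : ℝ)) * (d : ℝ) ^ (-(d : ℝ))) (by positivity)
  obtain ⟨n, hn⟩ := (F.image fun x => (x ⟨0, hd⟩).natAbs).exists_nat_subset_range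
  let N := n + 1
  let B : Finset (Fin d → ℤ) := Finset.univ.map
    ⟨fun r : Fin d → Fin N => (blockEquiv d N).symm (y, r), fun r r' hr => by simpa using hr⟩
  have hdisj : Disjoint B F := by
    rw [Finset.disjoint_left]
    intro x hx hxF
    obtain ⟨r, -, rfl⟩ := Finset.mem_map.1 hx
    have h1 := Finset.mem_range.1 (hn (Finset.mem_image_of_mem _ hxF))
    change ((blockEquiv d N).symm (y, r) ⟨0, hd⟩).natAbs < n at h1
    simp only [blockEquiv_symm_apply, y, N] at h1
    omega
  have hB := hF B hdisj
  refine absurd hB (not_lt.2 ?_)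
  rw [Finset.sum_map]
  refine le_trans ?_ (le_abs_self _)
  have hN : (0 : ℝ) < N := by positivity
  calc (1 + d : ℝ) ^ (-(d : ℝ)) * (d : ℝ) ^ (-(d : ℝ))
      = ∑ _r : Fin d → Fin N, ((1 + d) * N : ℝ) ^ (-(d : ℝ)) * l1norm y ^ (-(d : ℝ)) := by
        rw [hy, mul_rpow (by positivity) hN.le, rpow_neg hN.le, rpow_natCast]
        simp only [Finset.sum_const, Finset.card_univ, Fintype.card_pi, Fintype.card_fin,
          Finset.prod_const, nsmul_eq_mul]
        push_cast
        field_simp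
    _ ≤ _ := Finset.sum_le_sum fun r _ => le_l1norm_blockEquiv_symm_rpow hd' y r

theorem tendsto_tsum_l1norm_rpow_atTop {d : ℕ} (hd : 1 ≤ d) :
    Tendsto (fun s => ∑' y : Fin d → ℤ, l1norm y ^ (-s)) (𝓝[>] (d : ℝ)) atTop := by
  have hnn (s : ℝ) (x : Fin d → ℤ) : 0 ≤ l1norm x ^ (-s) := rpow_nonneg (l1norm_nonneg x) _
  have hd' : (0 : ℝ) < d := by exact_mod_cast hd
  rw [tendsto_atTop]
  intro M
  obtain ⟨F, hF⟩ : ∃ F : Finset (Fin d → ℤ), M < ∑ x ∈ F, l1norm x ^ (-(d : ℝ)) := by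
    by_contra! h
    exact not_summable_l1norm_rpow hd (summable_of_sum_le (hnn d) h)
  have hcont : ContinuousAt (fun s : ℝ => ∑ x ∈ F, l1norm x ^ (-s)) d := by
    refine tendsto_finsetSum _ fun x _ => ?_
    rcases eq_or_ne x 0 with rfl | hx
    · rw [l1norm_zero]
      exact (continuousAt_const_rpow' (by linarith)).comp continuousAt_neg
    · exact (continuousAt_const_rpow (one_pos.trans_le (one_le_l1norm hx)).ne').comp
        continuousAt_neg
  filter_upwards [nhdsWithin_le_nhds (hcont.eventually (lt_mem_nhds hF)), self_mem_nhdsWithin]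
    with s hs hds
  exact hs.le.trans ((summable_l1norm_rpow hds).sum_le_tsum F fun x _ => hnn s x)

theorem tsum_powerlaw_sq_le {d : ℕ} (hd : 1 ≤ d) {s : ℝ} (hs : (d : ℝ) < s) :
    ∑' x : Fin d → ℤ, powerlaw d s x ^ 2 ≤ (∑' y : Fin d → ℤ, l1norm y ^ (-s))⁻¹ := by
  have hs0 : 0 < s := lt_of_le_of_lt (Nat.cast_nonneg d) hs
  have h := (hasSum_powerlaw hd hs).mul_left (∑' y : Fin d → ℤ, l1norm y ^ (-s))⁻¹
  rw [mul_one] at h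
  have hle (x : Fin d → ℤ) : powerlaw d s x ^ 2 ≤
      (∑' y : Fin d → ℤ, l1norm y ^ (-s))⁻¹ * powerlaw d s x := by
    rw [sq]
    exact mul_le_mul_of_nonneg_right (powerlaw_le hs0 x) (powerlaw_nonneg d s x)
  exact hasSum_le hle (h.summable.of_nonneg_of_le (fun x => sq_nonneg _) hle).hasSum h

theorem isCompact_brillouin (d : ℕ) : IsCompact (brillouin d) :=
  isCompact_Icc

theorem volume_restrict_brillouin (d : ℕ) :
    (volume : Measure (Fin d → ℝ)).restrict (brillouin d) =
      Measure.pi fun _ => (volume : Measure ℝ).restrict (Icc (-π) π) := by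
  rw [← Measure.restrict_pi_pi, brillouin, ← Set.pi_univ_Icc, volume_pi]

theorem integral_exp_int_mul (m : ℤ) :
    ∫ t in Icc (-π) π, Complex.exp (Complex.I * (t * (m : ℝ) : ℝ)) =
      if m = 0 then (2 * π : ℂ) else 0 := by
  rw [integral_Icc_eq_integral_Ioc,
    ← intervalIntegral.integral_of_le (by linarith [pi_pos])]
  split_ifs with hm
  · simp [hm]
    ring
  · have hc : (m : ℂ) * Complex.I ≠ 0 :=
      mul_ne_zero (by exact_mod_cast hm) Complex.I_ne_zero
    have h := integral_exp_mul_complex (a := -π) (b := π) hc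
    have hfun (t : ℝ) : Complex.exp (Complex.I * (t * (m : ℝ) : ℝ)) =
        Complex.exp ((m : ℂ) * Complex.I * t) := by
      congr 1
      push_cast
      ring
    simp only [hfun]
    rw [h, div_eq_zero_iff, sub_eq_zero]
    left
    rw [Complex.exp_eq_exp_iff_exists_int]
    refine ⟨m, ?_⟩
    push_cast
    ring

theorem integral_cos_int_mul {d : ℕ} (m : Fin d → ℤ) :
    ∫ k in brillouin d, Real.cos (∑ i, k i * (m i : ℝ)) =
      if m = 0 then (2 * π) ^ d else 0 := by
  have hcos (k : Fin d → ℝ) : Real.cos (∑ i, k i * (m i : ℝ)) =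
      Complex.reCLM (∏ i, Complex.exp (Complex.I * (k i * (m i : ℝ) : ℝ))) := by
    rw [← Complex.exp_sum, ← Finset.mul_sum, Complex.reCLM_apply,
      ← Complex.exp_ofReal_mul_I_re, mul_comm]
    push_cast
    rfl
  have hint : IntegrableOn
      (fun k : Fin d → ℝ => ∏ i, Complex.exp (Complex.I * (k i * (m i : ℝ) : ℝ)))
      (brillouin d) :=
    ContinuousOn.integrableOn_compact (isCompact_brillouin d) (by fun_prop)
  simp only [hcos]
  rw [Complex.reCLM.integral_comp_comm hint, volume_restrict_brillouin,
    integral_fintype_prod_eq_prod fun i t => Complex.exp (Complex.I * (t * (m i : ℝ) : ℝ))]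
  simp only [integral_exp_int_mul]
  split_ifs with hm
  · simp only [hm, Pi.zero_apply, if_true, Finset.prod_const, Finset.card_univ, Fintype.card_fin]
    rw [Complex.reCLM_apply]
    exact_mod_cast Complex.ofReal_re ((2 * π) ^ d)
  · obtain ⟨i, hi⟩ := Function.ne_iff.1 hm
    rw [Finset.prod_eq_zero (Finset.mem_univ i) (if_neg hi), map_zero]

theorem integral_cos_mul_cos {d : ℕ} (x y : Fin d → ℤ) :
    ∫ k in brillouin d, Real.cos (∑ i, k i * (x i : ℝ)) * Real.cos (∑ i, k i * (y i : ℝ)) =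
      (2 * π) ^ d / 2 * ((if x = y then 1 else 0) + if x = -y then 1 else 0) := by
  have hprod (k : Fin d → ℝ) :
      Real.cos (∑ i, k i * (x i : ℝ)) * Real.cos (∑ i, k i * (y i : ℝ)) =
      1 / 2 * (Real.cos (∑ i, k i * (((x - y) i : ℤ) : ℝ)) +
        Real.cos (∑ i, k i * (((x + y) i : ℤ) : ℝ))) := by
    simp only [Pi.sub_apply, Pi.add_apply, Int.cast_sub, Int.cast_add, mul_sub, mul_add,
      Finset.sum_sub_distrib, Finset.sum_add_distrib]
    rw [cos_sub, cos_add]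
    ring
  have hint (z : Fin d → ℤ) :
      IntegrableOn (fun k : Fin d → ℝ => Real.cos (∑ i, k i * (z i : ℝ))) (brillouin d) :=
    ContinuousOn.integrableOn_compact (isCompact_brillouin d) (by fun_prop)
  simp only [hprod]
  rw [integral_const_mul, integral_add (hint _) (hint _), integral_cos_int_mul,
    integral_cos_int_mul]
  simp only [sub_eq_zero, add_eq_zero_iff_eq_neg]
  split_ifs <;> ring

theorem continuous_jhat {d : ℕ} {J : (Fin d → ℤ) → ℝ} (hJ : Summable J) :
    Continuous (jhat d J) := by
  refine continuous_tsum (fun x => by fun_prop) hJ.abs fun x k => ?_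
  rw [norm_mul, Real.norm_eq_abs, Real.norm_eq_abs]
  exact mul_le_of_le_one_right (abs_nonneg _) (abs_cos_le_one _)

theorem hasSum_integral_jhat_mul {d : ℕ} {J : (Fin d → ℤ) → ℝ} (hJ : Summable J)
    {g : (Fin d → ℝ) → ℝ} (hg : Continuous g) :
    HasSum (fun x : Fin d → ℤ => J x * ∫ k in brillouin d, Real.cos (∑ i, k i * (x i : ℝ)) * g k)
      (∫ k in brillouin d, jhat d J k * g k) := by
  have hint {f : (Fin d → ℝ) → ℝ} (hf : Continuous f) : IntegrableOn f (brillouin d) :=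
    hf.continuousOn.integrableOn_compact (isCompact_brillouin d)
  have h := hasSum_integral_of_summable_integral_norm
    (μ := (volume : Measure (Fin d → ℝ)).restrict (brillouin d))
    (F := fun (x : Fin d → ℤ) k => J x * (Real.cos (∑ i, k i * (x i : ℝ)) * g k))
    (fun x => hint (by fun_prop)) ?_
  · simp only [integral_const_mul] at h
    convert! h using 3 with k
    rw [jhat, ← tsum_mul_right]
    simp only [mul_assoc]
  · refine (hJ.abs.mul_right (∫ k in brillouin d, |g k|)).of_nonneg_of_le
      (fun x => integral_nonneg fun k => norm_nonneg _) fun x => ?_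
    rw [← integral_const_mul]
    refine integral_mono (hint (by fun_prop)) (hint (by fun_prop)) fun k => ?_
    simp only [norm_mul, Real.norm_eq_abs]
    gcongr
    exact mul_le_of_le_one_left (abs_nonneg _) (abs_cos_le_one _)

theorem integral_jhat_sq {d : ℕ} {J : (Fin d → ℤ) → ℝ} (hJ : Summable J)
    (heven : ∀ x, J (-x) = J x) :
    ∫ k in brillouin d, jhat d J k ^ 2 = (2 * π) ^ d * ∑' x, J x ^ 2 := by
  have hcoeff (x : Fin d → ℤ) :
      ∫ k in brillouin d, Real.cos (∑ i, k i * (x i : ℝ)) * jhat d J k =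
        (2 * π) ^ d * J x := by
    have h := (hasSum_integral_jhat_mul hJ
      (g := fun k => Real.cos (∑ i, k i * (x i : ℝ))) (by fun_prop)).tsum_eq
    simp only [mul_comm (jhat d J _)] at h
    rw [← h]
    simp only [integral_cos_mul_cos]
    have hterm (y : Fin d → ℤ) :
        J y * ((2 * π) ^ d / 2 * ((if y = x then 1 else 0) + if y = -x then 1 else 0)) =
        (if y = x then (2 * π) ^ d / 2 * J x else 0) +
          if y = -x then (2 * π) ^ d / 2 * J x else 0 := by
      split_ifs with h1 h2 h2 <;> simp [*] <;> ring
    simp only [hterm]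
    rw [((hasSum_ite_eq x _).add (hasSum_ite_eq (-x) _)).tsum_eq]
    ring
  have h := (hasSum_integral_jhat_mul hJ (continuous_jhat hJ)).tsum_eq
  simp only [hcoeff, ← sq] at h
  rw [← h, ← tsum_mul_left]
  refine tsum_congr fun x => ?_
  ring

theorem integrableOn_abs_apply_rpow {d : ℕ} (j : Fin d) {r : ℝ} (hr : -1 < r) :
    IntegrableOn (fun k : Fin d → ℝ => |k j| ^ r) (brillouin d) := by
  have h1 : IntegrableOn (fun t : ℝ => |t| ^ r) (Icc (-π) π) := by
    rw [integrableOn_Icc_iff_integrableOn_Ioc,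
      ← intervalIntegrable_iff_integrableOn_Ioc_of_le (by linarith [pi_pos])]
    have hpos : IntervalIntegrable (fun t : ℝ => |t| ^ r) volume 0 π := by
      refine (intervalIntegral.intervalIntegrable_rpow' (a := 0) (b := π) hr).congr fun t ht => ?_
      rw [uIoc_of_le pi_pos.le] at ht
      simp only [abs_of_pos ht.1]
    refine IntervalIntegrable.trans ?_ hpos
    simpa using ((IntervalIntegrable.iff_comp_neg (by simp)).1 hpos).symm
  rw [IntegrableOn, volume_restrict_brillouin]
  exact integrable_comp_eval (μ := fun _ : Fin d => (volume : Measure ℝ).restrict (Icc (-π) π)) h1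

theorem integral_jhat_sq_div_le {d : ℕ} {J : (Fin d → ℤ) → ℝ} (hJ : HasSum J 1)
    (hJ0 : ∀ x, 0 ≤ J x) (heven : ∀ x, J (-x) = J x) {C : ℝ} (hC : 0 < C) (j : Fin d)
    (hlow : ∀ k ∈ brillouin d, k ≠ 0 →
      C * Real.sqrt (∑ i, k i ^ 2) ^ (1 / 4 : ℝ) ≤ 1 - jhat d J k) {l : ℝ} (hl : 0 < l) :
    ∫ k in brillouin d, jhat d J k ^ 2 / (1 - jhat d J k) ≤
      l / 2 * ((2 * π) ^ d * ∑' x, J x ^ 2) +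
        (2 * l * C ^ 2)⁻¹ * ∫ k in brillouin d, |k j| ^ (-1 / 2 : ℝ) := by
  have hle (k : Fin d → ℝ) : jhat d J k ≤ 1 := by
    have := (hasSum_one_sub_jhat hJ k).nonneg fun x =>
      mul_nonneg (hJ0 x) (sub_nonneg.2 (cos_le_one _))
    linarith
  have hge (k : Fin d → ℝ) : -1 ≤ jhat d J k := by
    have := (hJ.add (summable_mul_cos hJ.summable k).hasSum).nonneg fun x => by
      have h := mul_nonneg (hJ0 x) (neg_le_iff_add_nonneg'.1
        (neg_one_le_cos (∑ i, k i * (x i : ℝ))))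
      linarith
    change 0 ≤ 1 + jhat d J k at this
    linarith
  have hsq : IntegrableOn (fun k => jhat d J k ^ 2) (brillouin d) :=
    ((continuous_jhat hJ.summable).pow 2).continuousOn.integrableOn_compact
      (isCompact_brillouin d)
  have hrp := integrableOn_abs_apply_rpow (d := d) j (r := -1 / 2) (by norm_num)
  rw [← integral_jhat_sq hJ.summable heven, ← integral_const_mul, ← integral_const_mul,
    ← integral_add (hsq.const_mul _) (hrp.const_mul _)]
  refine integral_mono_of_nonneg
    (ae_of_all _ fun k => div_nonneg (sq_nonneg _) (sub_nonneg.2 (hle k)))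
    ((hsq.const_mul _).add (hrp.const_mul _)) ?_
  have hae : ∀ᵐ k : Fin d → ℝ, k j ≠ 0 := by
    rw [volume_pi]
    exact compl_mem_ae_iff.2 (Measure.pi_hyperplane _ j 0)
  filter_upwards [ae_restrict_of_ae hae, ae_restrict_mem (isCompact_brillouin d).measurableSet]
    with k hkj hk
  have hkj' : 0 < |k j| := abs_pos.2 hkj
  have hroot : 0 < |k j| ^ (1 / 4 : ℝ) := rpow_pos_of_pos hkj' _
  have hden : C * |k j| ^ (1 / 4 : ℝ) ≤ 1 - jhat d J k := by
    refine le_trans ?_ (hlow k hk fun h => hkj (congrFun h j))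
    gcongr
    refine Real.le_sqrt_of_sq_le ?_
    rw [sq_abs]
    exact Finset.single_le_sum (f := fun i => k i ^ 2) (fun _ _ => sq_nonneg _)
      (Finset.mem_univ j)
  have hpow : |k j| ^ (-1 / 2 : ℝ) = ((|k j| ^ (1 / 4 : ℝ))⁻¹) ^ 2 := by
    rw [← rpow_neg hkj'.le, ← rpow_natCast, ← rpow_mul hkj'.le]
    norm_num
  rw [hpow]
  set u := |k j| ^ (1 / 4 : ℝ)
  have hsq_le : jhat d J k ^ 2 ≤ |jhat d J k| := by
    rw [← sq_abs, sq]
    exact mul_le_of_le_one_left (abs_nonneg _) (abs_le.2 ⟨hge k, hle k⟩)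
  calc jhat d J k ^ 2 / (1 - jhat d J k) ≤ |jhat d J k| / (C * u) := by gcongr
    _ = |jhat d J k| * (C * u)⁻¹ := div_eq_mul_inv _ _
    _ ≤ l / 2 * |jhat d J k| ^ 2 + (2 * l)⁻¹ * (C * u)⁻¹ ^ 2 := by
        have h2 : l / 2 * |jhat d J k| ^ 2 + (2 * l)⁻¹ * (C * u)⁻¹ ^ 2 -
            |jhat d J k| * (C * u)⁻¹ = (2 * l)⁻¹ * (l * |jhat d J k| - (C * u)⁻¹) ^ 2 := by
          field_simp
          ring
        have h3 : 0 ≤ (2 * l)⁻¹ * (l * |jhat d J k| - (C * u)⁻¹) ^ 2 := by positivity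
        linarith
    _ = l / 2 * jhat d J k ^ 2 + (2 * l * C ^ 2)⁻¹ * u⁻¹ ^ 2 := by
        rw [sq_abs]
        field_simp

/-- Infrared bounds for the power-law interactions (Lemma 4.9). -/
theorem powerlaw_ir_bounds (d : ℕ) (hd : 1 ≤ d) :
    -- (1) `1 - Ĵ_s(k) ≥ C |k|^{d-δ}` uniformly in `s` close to `d`
    (∀ δ : ℝ, 0 < δ → δ < d →
      ∃ C : ℝ, 0 < C ∧ ∃ s₀ : ℝ, (d : ℝ) < s₀ ∧ ∀ s : ℝ, (d : ℝ) < s → s ≤ s₀ →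
        ∀ k ∈ brillouin d, k ≠ 0 →
          C * Real.sqrt (∑ i, k i ^ 2) ^ ((d : ℝ) - δ) ≤ 1 - jhat d (powerlaw d s) k) ∧
    -- (2) the ℓ² norm vanishes as `s ↓ d`
    Tendsto (fun s => ∑' x : Fin d → ℤ, powerlaw d s x ^ 2) (𝓝[>] (d : ℝ)) (𝓝 0) ∧
    -- hence, in every dimension `d ≥ 1`, the infrared integral vanishes as `s ↓ d`
    Tendsto (fun s => irIntegral d (powerlaw d s)) (𝓝[>] (d : ℝ)) (𝓝 0) := by
  have hinv := (tendsto_tsum_l1norm_rpow_atTop hd).inv_tendsto_atTop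
  have hmem : ∀ᶠ s in 𝓝[>] (d : ℝ), (d : ℝ) < s := self_mem_nhdsWithin
  refine ⟨fun δ _ hδ => infrared_lower_bound hd hδ, ?_, ?_⟩
  · refine tendsto_of_tendsto_of_tendsto_of_le_of_le' tendsto_const_nhds hinv
      (Eventually.of_forall fun s => tsum_nonneg fun x => sq_nonneg _) ?_
    filter_upwards [hmem] with s hs using tsum_powerlaw_sq_le hd hs
  · have hd' : (1 : ℝ) ≤ d := by exact_mod_cast hd
    obtain ⟨C, hC, s₀, hs₀, hlow⟩ := infrared_lower_bound hd (δ := d - 1 / 4) (by linarith)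
    rw [sub_sub_cancel] at hlow
    let j : Fin d := ⟨0, hd⟩
    have hbound : Tendsto (fun s => 1 / (2 * π) ^ d * ((2 * π) ^ d / 2 +
        (2 * C ^ 2)⁻¹ * ∫ k in brillouin d, |k j| ^ (-1 / 2 : ℝ)) *
        Real.sqrt (∑' y : Fin d → ℤ, l1norm y ^ (-s))⁻¹) (𝓝[>] (d : ℝ)) (𝓝 0) := by
      have h := ((Real.continuous_sqrt.tendsto 0).comp hinv).const_mul
        (1 / (2 * π) ^ d * ((2 * π) ^ d / 2 +
          (2 * C ^ 2)⁻¹ * ∫ k in brillouin d, |k j| ^ (-1 / 2 : ℝ)))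
      rwa [Real.sqrt_zero, mul_zero] at h
    refine tendsto_of_tendsto_of_tendsto_of_le_of_le' tendsto_const_nhds hbound ?_ ?_
    · filter_upwards [hmem] with s hs
      refine mul_nonneg (by positivity) (integral_nonneg fun k =>
        div_nonneg (sq_nonneg _) ?_)
      exact (hasSum_one_sub_jhat (hasSum_powerlaw hd hs) k).nonneg fun x =>
        mul_nonneg (powerlaw_nonneg d s x) (sub_nonneg.2 (cos_le_one _))
    · filter_upwards [hmem, nhdsWithin_le_nhds (Iic_mem_nhds hs₀)] with s hs hs'
      have hZ := inv_pos.2 (tsum_l1norm_rpow_pos hd hs)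
      have hS := tsum_powerlaw_sq_le hd hs
      set c := (∑' y : Fin d → ℤ, l1norm y ^ (-s))⁻¹
      have hc := Real.sqrt_pos.2 hZ
      have hcc := Real.sq_sqrt hZ.le
      set q := Real.sqrt c
      rw [irIntegral, mul_assoc]
      refine mul_le_mul_of_nonneg_left ?_ (by positivity)
      refine (integral_jhat_sq_div_le (hasSum_powerlaw hd hs) (powerlaw_nonneg d s)
        (powerlaw_neg d s) hC j (hlow s hs hs') (inv_pos.2 hc)).trans ?_
      calc q⁻¹ / 2 * ((2 * π) ^ d * ∑' x, powerlaw d s x ^ 2) +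
            (2 * q⁻¹ * C ^ 2)⁻¹ * ∫ k in brillouin d, |k j| ^ (-1 / 2 : ℝ)
          ≤ q⁻¹ / 2 * ((2 * π) ^ d * q ^ 2) +
            (2 * q⁻¹ * C ^ 2)⁻¹ * ∫ k in brillouin d, |k j| ^ (-1 / 2 : ℝ) := by
            rw [hcc]
            gcongr
        _ = _ := by
            field_simp
end
end

section
/- Let d ≥ 1 and μ > 0. Let H = { x ∈ ℤ^d : x₁ ≥ 1 } be the half-space and let θ : ℤ^d → ℤ^d be the reflection θ(x₁, x₂, ..., x_d) = (1 − x₁, x₂, ..., x_d), which maps ℤ^d \ H bijectively onto H. Then for every absolutely summable function f : H → ℝ, the quadratic form Σ_{x ∈ H} Σ_{y ∈ ℤ^d \ H} e^{−μ |x−y|₁} f(x) f(θ(y)) is nonnegative; i.e., the Yukawa kernel J(x,y) = e^{−μ|x−y|₁} is reflection positive through the plane between the columns x₁ = 0 and x₁ = 1. -/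
open Real Set

noncomputable section

open Matrix in
/-- The exponential (Ornstein–Uhlenbeck) kernel on the line is positive semidefinite. -/
theorem posSemidef_exp_neg_abs_sub {ι : Type*} [Finite ι] (t : ι → ℝ) :
    (Matrix.of fun i j => Real.exp (-|t i - t j|)).PosSemidef := by
  have hmin : (Matrix.of fun i j => min (Real.exp (2 * t i)) (Real.exp (2 * t j))).PosSemidef := by
    have : (Matrix.of fun i j => min (Real.exp (2 * t i)) (Real.exp (2 * t j))) =
        Matrix.of fun i j => MeasureTheory.volume.real
          (Icc 0 (Real.exp (2 * t i)) ∩ Icc 0 (Real.exp (2 * t j))) := by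
      ext i j
      simp [Icc_inter_Icc, Real.exp_nonneg]
    rw [this]
    exact MeasureTheory.posSemidef_matrix_measure_inter (fun _ => measurableSet_Icc)
      fun _ => isCompact_Icc.measure_ne_top
  suffices hmul : (Matrix.of fun i j => Real.exp (-|t i - t j|)) =
      vecMulVec (fun i => Real.exp (-t i)) (star fun i => Real.exp (-t i)) ⊙
        Matrix.of fun i j => min (Real.exp (2 * t i)) (Real.exp (2 * t j)) by
    rw [hmul]
    exact (posSemidef_vecMulVec_self_star _).hadamard hmin
  ext i j
  simp only [of_apply, hadamard_apply, vecMulVec_apply, star_trivial,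
    ← Real.exp_monotone.map_min, ← Real.exp_add]
  congr 1
  rcases le_total (t i) (t j) with h | h
  · rw [abs_of_nonpos (by linarith), min_eq_left (by linarith)]; ring
  · rw [abs_of_nonneg (by linarith), min_eq_right (by linarith)]; ring

/-- Tensor products of exponential kernels are positive semidefinite. -/
theorem posSemidef_exp_neg_sum_abs_sub {ι κ : Type*} [Finite ι] (s : Finset κ)
    (t : κ → ι → ℝ) :
    (Matrix.of fun i j => Real.exp (-∑ k ∈ s, |t k i - t k j|)).PosSemidef := by
  classical
  induction s using Finset.induction_on with
  | empty =>
    convert Matrix.posSemidef_vecMulVec_self_star (fun _ : ι => (1 : ℝ)) using 1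
    ext i j
    simp [Matrix.vecMulVec_apply]
  | insert a s ha ih =>
    have hmul : (Matrix.of fun i j => Real.exp (-∑ k ∈ insert a s, |t k i - t k j|)) =
        Matrix.hadamard (Matrix.of fun i j => Real.exp (-|t a i - t a j|))
          (Matrix.of fun i j => Real.exp (-∑ k ∈ s, |t k i - t k j|)) := by
      ext i j
      simp [Finset.sum_insert ha, ← Real.exp_add, add_comm]
    rw [hmul]
    exact (posSemidef_exp_neg_abs_sub (t a)).hadamard ih

/-- A kernel all of whose finite restrictions are positive semidefinite has a nonnegative
infinite quadratic form. -/
theorem tsum_nonneg_of_posSemidef {α : Type*} (K : α → α → ℝ) (g : α → ℝ)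
    (hK : ∀ s : Finset α, (Matrix.of fun i j : s => K i j).PosSemidef) :
    0 ≤ ∑' p : α × α, K p.1 p.2 * g p.1 * g p.2 := by
  by_cases h : Summable fun p : α × α => K p.1 p.2 * g p.1 * g p.2
  · refine ge_of_tendsto' (h.hasSum.comp
      (Filter.tendsto_finsetProd_atTop.comp Filter.tendsto_atTop_diagonal)) fun s => ?_
    have hs := (hK s).dotProduct_mulVec_nonneg fun i => g i
    simp only [dotProduct, Matrix.mulVec, Matrix.of_apply, Pi.star_apply, star_trivial] at hs
    rw [Finset.sum_coe_sort s fun i => g i * ∑ j : s, K i j * g j] at hs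
    simp only [fun i => Finset.sum_coe_sort s fun j => K i j * g j] at hs
    simp only [Function.comp_apply, Finset.sum_product]
    convert hs using 2 with i
    rw [Finset.mul_sum]
    exact Finset.sum_congr rfl fun j _ => by ring
  · exact (tsum_eq_zero_of_not_summable h).ge

/-- The reflection in coordinate `a` exchanging the columns `0` and `1`, as a bijection between
the half-space `1 ≤ x a` and its complement. -/
def halfSpaceReflection {κ : Type*} [DecidableEq κ] (a : κ) :
    {x : κ → ℤ // 1 ≤ x a} ≃ {y : κ → ℤ // ¬ 1 ≤ y a} where
  toFun x := ⟨fun i => if i = a then 1 - x.1 a else x.1 i, by have := x.2; simp; omega⟩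
  invFun y := ⟨fun i => if i = a then 1 - y.1 a else y.1 i, by have := y.2; simp; omega⟩
  left_inv x := by ext i; by_cases h : i = a <;> simp [h]
  right_inv y := by ext i; by_cases h : i = a <;> simp [h]

/-- Reflection positivity of the Yukawa kernel `e^{-μ|x-y|₁}` through the plane
between the columns `x₁ = 0` and `x₁ = 1` (Remark 4.4(2)). -/
theorem yukawa_reflection_positive (d : ℕ) (hd : 1 ≤ d) (μ : ℝ) (hμ : 0 < μ)
    (f : (Fin d → ℤ) → ℝ) (hf : Summable fun x => |f x|) :
    0 ≤ ∑' p : {x : Fin d → ℤ // 1 ≤ x ⟨0, hd⟩} × {y : Fin d → ℤ // ¬ 1 ≤ y ⟨0, hd⟩},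
        Real.exp (-μ * l1norm ((p.1 : Fin d → ℤ) - (p.2 : Fin d → ℤ))) * f (p.1 : Fin d → ℤ) *
          f (fun i => if i = ⟨0, hd⟩ then 1 - (p.2 : Fin d → ℤ) ⟨0, hd⟩
            else (p.2 : Fin d → ℤ) i) := by
  set a : Fin d := ⟨0, hd⟩
  have key := tsum_nonneg_of_posSemidef
    (fun x z : {x : Fin d → ℤ // 1 ≤ x a} =>
      Real.exp (-∑ i ∈ Finset.univ.erase a, |μ * x.1 i - μ * z.1 i|))
    (fun x => Real.exp (μ / 2 - μ * x.1 a) * f x.1)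
    fun s => posSemidef_exp_neg_sum_abs_sub _ fun i (x : s) => μ * (x.1.1 i : ℝ)
  rw [← ((Equiv.refl _).prodCongr (halfSpaceReflection a)).tsum_eq]
  convert key using 1
  refine tsum_congr fun ⟨x, z⟩ => ?_
  have hx : (1 : ℝ) ≤ x.1 a := by exact_mod_cast x.2
  have hz : (1 : ℝ) ≤ z.1 a := by exact_mod_cast z.2
  have hrefl : (fun i => if i = a then 1 - (halfSpaceReflection a z).1 a
      else (halfSpaceReflection a z).1 i) = z.1 :=
    congrArg Subtype.val ((halfSpaceReflection a).symm_apply_apply z)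
  have hdist : -μ * l1norm (x.1 - (halfSpaceReflection a z).1) =
      -(∑ i ∈ Finset.univ.erase a, |μ * x.1 i - μ * z.1 i|) +
        (μ / 2 - μ * x.1 a) + (μ / 2 - μ * z.1 a) := by
    have ha : |((x.1 - (halfSpaceReflection a z).1) a : ℝ)| = x.1 a + z.1 a - 1 := by
      simp only [halfSpaceReflection, Equiv.coe_fn_mk, Pi.sub_apply, if_true]
      push_cast
      rw [abs_of_nonneg (by linarith)]
      ring
    have hrest : ∑ i ∈ Finset.univ.erase a, |μ * x.1 i - μ * z.1 i| =
        μ * ∑ i ∈ Finset.univ.erase a, |((x.1 - (halfSpaceReflection a z).1) i : ℝ)| := by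
      rw [Finset.mul_sum]
      refine Finset.sum_congr rfl fun i hi => ?_
      simp [halfSpaceReflection, Finset.ne_of_mem_erase hi, ← mul_sub, abs_mul, abs_of_pos hμ]
    rw [l1norm, ← Finset.add_sum_erase _ _ (Finset.mem_univ a), ha, hrest]
    ring
  simp only [Equiv.prodCongr_apply, Prod.map_apply, Equiv.refl_apply]
  rw [hrefl, hdist, Real.exp_add, Real.exp_add]
  ring
end
end
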